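/- arXiv:0712.1653 — 3 statements merged into one kernel-verified Lean document; each statement's English description precedes it below -/
import Mathlib

section
/- Let p and l₂ be distinct primes, let l₁ be a positive integer with p ∤ l₁, and let s ≥ 0 be the exact power of l₂ dividing l₁ (i.e. l₂^s ∣ l₁ and l₂^{s+1} ∤ l₁). Let G = P ⋊ ℤ/(l₁l₂) be a semidirect product of a finite p-group P by the cyclic group ℤ/(l₁l₂). Suppose G has a normal subgroup N ≅ ℤ/l₂^{s+1} such that the quotient G/N is cyclic of order l₁l₂^{−s}p^m, where p^m = |P|. Then G is isomorphic to the direct product ℤ/p^m × ℤ/(l₁l₂); in particular G is abelian. -/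
/-- **Group-theoretic lemma.** Let `p, l₂` be distinct primes, `l₁ > 0` with `p ∤ l₁`, and
`s` the exact power of `l₂` dividing `l₁`. Let `G = P ⋊ ℤ/(l₁l₂)` with `P` a `p`-group of
order `p^m`. If `G` has a normal subgroup `N ≅ ℤ/l₂^{s+1}` with `G/N` cyclic of order
`l₁ l₂^{-s} p^m`, then `G ≅ ℤ/p^m × ℤ/(l₁l₂)`. -/
theorem semidirect_product_is_abelian_of_cyclic_normal_subgroup
    (p l₁ l₂ s m : ℕ) (hp : p.Prime) (hl₂ : l₂.Prime) (hne : p ≠ l₂)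
    (hl₁ : 0 < l₁) (hpl₁ : ¬ p ∣ l₁)
    (hs : l₂ ^ s ∣ l₁) (hs' : ¬ l₂ ^ (s + 1) ∣ l₁)
    (P : Type*) [Group P] (hP : Nat.card P = p ^ m)
    (φ : Multiplicative (ZMod (l₁ * l₂)) →* MulAut P)
    (N : Subgroup (P ⋊[φ] Multiplicative (ZMod (l₁ * l₂)))) [N.Normal]
    (hN : Nonempty (N ≃* Multiplicative (ZMod (l₂ ^ (s + 1)))))
    (hquot : Nonempty (((P ⋊[φ] Multiplicative (ZMod (l₁ * l₂))) ⧸ N) ≃*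
      Multiplicative (ZMod (l₁ / l₂ ^ s * p ^ m)))) :
    Nonempty ((P ⋊[φ] Multiplicative (ZMod (l₁ * l₂))) ≃*
      Multiplicative (ZMod (p ^ m)) × Multiplicative (ZMod (l₁ * l₂))) := by
  obtain ⟨eN⟩ := hN
  obtain ⟨eQ⟩ := hquot
  have hcardN : Nat.card N = l₂ ^ (s + 1) :=
    (Nat.card_congr (eN.toEquiv.trans Multiplicative.toAdd)).trans (Nat.card_zmod _)
  have inl_mem_eq_one : ∀ a : P, SemidirectProduct.inl a ∈ N → a = 1 := by
    intro a ha
    have hdvd : orderOf a ∣ l₂ ^ (s + 1) := by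
      rw [← hcardN, ← orderOf_injective _ (SemidirectProduct.inl_injective (φ := φ)) a]
      exact Subgroup.orderOf_dvd_natCard N ha
    have hdvd' : orderOf a ∣ p ^ m := hP ▸ orderOf_dvd_natCard a
    exact orderOf_eq_one_iff.mp (Nat.eq_one_of_dvd_coprimes
      (((Nat.coprime_primes hp hl₂).mpr hne).pow m (s + 1)) hdvd' hdvd)
  have hφ : φ = 1 := by
    refine MonoidHom.ext fun c => MulEquiv.ext fun a => ?_
    refine mul_inv_eq_one.mp (inl_mem_eq_one (φ c a * a⁻¹) ?_)
    rw [← QuotientGroup.eq_one_iff, map_mul, SemidirectProduct.inl_aut]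
    apply eQ.injective
    simp
  subst hφ
  have hinj : Function.Injective (eQ.toMonoidHom.comp
      ((QuotientGroup.mk' N).comp SemidirectProduct.inl)) := by
    rw [injective_iff_map_eq_one]
    intro a ha
    exact inl_mem_eq_one a ((QuotientGroup.eq_one_iff _).mp (eQ.map_eq_one_iff.mp ha))
  have hcyc : IsCyclic P := isCyclic_of_injective _ hinj
  have hcardP : Nat.card P = Nat.card (Multiplicative (ZMod (p ^ m))) :=
    hP.trans ((Nat.card_congr Multiplicative.toAdd).trans (Nat.card_zmod _)).symm
  exact ⟨SemidirectProduct.mulEquivProd.trans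
    ((mulEquivOfCyclicCardEq hcardP).prodCongr (MulEquiv.refl _))⟩
end

section
/- Let n ≥ 3, let q ≥ 1 and d ≥ 1 be integers, and let G = D_{2n} be the dihedral group of order 2n. Suppose x₁, …, x_d ∈ G generate G, satisfy x₁x₂⋯x_d = 1, and satisfy the cyclic conjugacy relations: x₁^q is conjugate in G to x₂, x₂^q is conjugate to x₃, …, and x_d^q is conjugate to x₁. Then n is odd and d is even. Equivalently: if n is even, no such tuple (x₁, …, x_d) exists; and if n is odd and d is odd, no such tuple exists. -/
/-- A predicate on `Fin d` that is stable under the cyclic successor holds everywhere as soon as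
it holds somewhere. -/
theorem Fin.forall_of_cyclic_succ {d : ℕ} [NeZero d] {P : Fin d → Prop}
    (hsucc : ∀ i, P i → P (i + 1)) {i : Fin d} (hi : P i) (j : Fin d) : P j := by
  have key : ∀ k : ℕ, P (i + Fin.ofNat d k) := by
    intro k
    induction k with
    | zero => simpa using hi
    | succ k ih =>
      convert hsucc _ ih using 1
      rw [add_assoc]
      congr 1
      ext
      simp [Fin.val_add]
  simpa using key (j - i).val

/-- If generators of a group satisfy the cyclic conjugacy relations, a homomorphism to a
commutative group that kills one of them is trivial. -/
theorem MonoidHom.eq_one_of_cyclic_isConj {G A : Type*} [Group G] [CommGroup A]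
    {d q : ℕ} [NeZero d] {x : Fin d → G} (hgen : Subgroup.closure (Set.range x) = ⊤)
    (hconj : ∀ i : Fin d, IsConj (x i ^ q) (x (i + 1))) (f : G →* A) {i : Fin d}
    (hi : f (x i) = 1) : f = 1 := by
  have hall : ∀ j, f (x j) = 1 := by
    refine Fin.forall_of_cyclic_succ (P := fun j => f (x j) = 1) (fun j hj => ?_) hi
    have h := isConj_iff_eq.1 (f.map_isConj (hconj j))
    rw [← h, map_pow, hj, one_pow]
  refine MonoidHom.eq_of_eqOn_dense hgen ?_
  rintro _ ⟨j, rfl⟩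
  exact hall j

namespace DihedralGroup

/-- The homomorphism to `ℤ/2` whose kernel is the subgroup of rotations. -/
def reflectionHom (n : ℕ) : DihedralGroup n →* Multiplicative (ZMod 2) where
  toFun
    | r _ => 1
    | sr _ => Multiplicative.ofAdd 1
  map_one' := rfl
  map_mul' := by
    have h : (1 : Multiplicative (ZMod 2)) = Multiplicative.ofAdd 1 * Multiplicative.ofAdd 1 := by
      decide
    rintro (a | a) (b | b)
    exacts [rfl, rfl, rfl, h]

/-- For even `n`, the homomorphism to `ℤ/2` sending `r i` and `sr i` to the parity of `i`. -/
def parityHom {n : ℕ} (h : 2 ∣ n) : DihedralGroup n →* Multiplicative (ZMod 2) where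
  toFun
    | r i => Multiplicative.ofAdd (ZMod.castHom h (ZMod 2) i)
    | sr i => Multiplicative.ofAdd (ZMod.castHom h (ZMod 2) i)
  map_one' := by
    change Multiplicative.ofAdd (ZMod.castHom h (ZMod 2) 0) = 1
    rw [map_zero, ofAdd_zero]
  map_mul' := by
    rintro (a | a) (b | b) <;>
      simp only [r_mul_r, r_mul_sr, sr_mul_r, sr_mul_sr, map_add, map_sub, ← ofAdd_add,
        CharTwo.sub_eq_add, add_comm]

end DihedralGroup

theorem Multiplicative.zmod_two_eq_ofAdd_one {a : Multiplicative (ZMod 2)} (ha : a ≠ 1) :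
    a = Multiplicative.ofAdd 1 := by
  revert a
  decide

/-- **Group-theoretic content for dihedral groups.** Let `n ≥ 3`, `q ≥ 1`, `d ≥ 1` and let
`x₁, …, x_d` generate the dihedral group `D_{2n}` of order `2n`, with `x₁ ⋯ x_d = 1` and
`x_i^q` conjugate to `x_{i+1}` (indices cyclically). Then `n` is odd and `d` is even. -/
theorem dihedral_cyclic_conjugacy_generators
    (n q d : ℕ) (hn : 3 ≤ n) (hq : 1 ≤ q) [NeZero d]
    (x : Fin d → DihedralGroup n)
    (hgen : Subgroup.closure (Set.range x) = ⊤)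
    (hprod : (List.ofFn x).prod = 1)
    (hconj : ∀ i : Fin d, IsConj (x i ^ q) (x (i + 1))) :
    Odd n ∧ Even d := by
  have ofAdd_one_ne : Multiplicative.ofAdd (1 : ZMod 2) ≠ 1 := by decide
  have hrefl : ∀ i, DihedralGroup.reflectionHom n (x i) = Multiplicative.ofAdd 1 := by
    refine fun i => Multiplicative.zmod_two_eq_ofAdd_one fun hi => ?_
    exact ofAdd_one_ne (DFunLike.congr_fun
      (MonoidHom.eq_one_of_cyclic_isConj hgen hconj _ hi) (DihedralGroup.sr 0))
  constructor
  · rw [← Nat.not_even_iff_odd]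
    intro heven
    let p := DihedralGroup.parityHom heven.two_dvd
    have hp : p (DihedralGroup.r 1) = Multiplicative.ofAdd 1 :=
      congrArg Multiplicative.ofAdd (map_one (ZMod.castHom heven.two_dvd (ZMod 2)))
    by_cases h0 : p (x 0) = 1
    · have h := DFunLike.congr_fun
        (MonoidHom.eq_one_of_cyclic_isConj hgen hconj p h0) (DihedralGroup.r 1)
      exact ofAdd_one_ne (hp.symm.trans h)
    · have h1 : (p * DihedralGroup.reflectionHom n) (x 0) = 1 := by
        rw [MonoidHom.mul_apply, hrefl, Multiplicative.zmod_two_eq_ofAdd_one h0]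
        decide
      have h := DFunLike.congr_fun
        (MonoidHom.eq_one_of_cyclic_isConj hgen hconj _ h1) (DihedralGroup.r 1)
      rw [MonoidHom.mul_apply, hp] at h
      exact ofAdd_one_ne h
  · have h := congrArg (DihedralGroup.reflectionHom n) hprod
    rw [map_one, map_list_prod, List.map_ofFn, List.prod_ofFn] at h
    simp only [Function.comp_apply, hrefl, Finset.prod_const, Finset.card_univ, Fintype.card_fin,
      ← ofAdd_nsmul, nsmul_eq_mul, mul_one, ofAdd_eq_one] at h
    exact (ZMod.natCast_eq_zero_iff_even).1 h
end

section
/- Let n > 2, let q ≥ 1 and d ≥ 1 be integers, and suppose x₁, …, x_d generate the symmetric group S_n, satisfy x₁x₂⋯x_d = 1, and satisfy the cyclic conjugacy relations: x₁^q is conjugate in S_n to x₂, x₂^q is conjugate to x₃, …, and x_d^q is conjugate to x₁. Then q is odd, each x_i is an odd permutation, and d is even. In particular, if q is even, or if both q and d are odd, no such tuple exists. -/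
/-- A generating set of a symmetric group on a nontrivial type contains an odd permutation. -/
theorem exists_sign_eq_neg_one_of_closure_range_eq_top {α ι : Type*} [Fintype α] [DecidableEq α]
    [Nontrivial α] {x : ι → Equiv.Perm α} (hx : Subgroup.closure (Set.range x) = ⊤) :
    ∃ i, Equiv.Perm.sign (x i) = -1 := by
  by_contra! h
  have hle : Subgroup.closure (Set.range x) ≤ (Equiv.Perm.sign (α := α)).ker := by
    rw [Subgroup.closure_le]
    rintro _ ⟨i, rfl⟩
    exact (Int.units_eq_one_or _).resolve_right (h i)
  obtain ⟨a, b, hab⟩ := exists_pair_ne α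
  have hswap : Equiv.swap a b ∈ (Equiv.Perm.sign (α := α)).ker := hle (hx ▸ Subgroup.mem_top _)
  rw [MonoidHom.mem_ker, Equiv.Perm.sign_swap hab] at hswap
  exact absurd hswap (by decide)

/-- A function on `Fin d` invariant under the cyclic shift is constant. -/
theorem Fin.eq_apply_zero_of_apply_add_one_eq {β : Type*} {d : ℕ} [NeZero d] {f : Fin d → β}
    (h : ∀ i, f (i + 1) = f i) (i : Fin d) : f i = f 0 := by
  obtain ⟨m, rfl⟩ := Nat.exists_eq_succ_of_ne_zero (NeZero.ne d)
  induction i using Fin.induction with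
  | zero => rfl
  | succ i ih => rw [← Fin.coeSucc_eq_succ, ← ih]; exact h _

/-- **Group-theoretic content for symmetric groups.** Let `n > 2`, `q ≥ 1`, `d ≥ 1` and let
`x₁, …, x_d` generate the symmetric group `S_n`, with `x₁ ⋯ x_d = 1` and `x_i^q` conjugate
to `x_{i+1}` (indices cyclically). Then `q` is odd, each `x_i` is an odd permutation, and
`d` is even. -/
theorem symmetric_cyclic_conjugacy_generators
    (n q d : ℕ) (hn : 2 < n) (hq : 1 ≤ q) [NeZero d]
    (x : Fin d → Equiv.Perm (Fin n))
    (hgen : Subgroup.closure (Set.range x) = ⊤)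
    (hprod : (List.ofFn x).prod = 1)
    (hconj : ∀ i : Fin d, IsConj (x i ^ q) (x (i + 1))) :
    Odd q ∧ (∀ i : Fin d, Equiv.Perm.sign (x i) = -1) ∧ Even d := by
  have : Nontrivial (Fin n) := Fin.nontrivial_iff_two_le.mpr hn.le
  obtain ⟨j, hj⟩ := exists_sign_eq_neg_one_of_closure_range_eq_top hgen
  have hsign (i : Fin d) : Equiv.Perm.sign (x (i + 1)) = Equiv.Perm.sign (x i) ^ q := by
    rw [← map_pow]
    exact (isConj_iff_eq.mp (Equiv.Perm.sign.map_isConj (hconj i))).symm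
  have hodd : Odd q := by
    rw [← Nat.not_even_iff_odd]
    intro heven
    have h := hsign (j - 1)
    rw [sub_add_cancel, hj, Int.units_pow_eq_pow_mod_two, Nat.even_iff.mp heven, pow_zero] at h
    exact absurd h (by decide)
  have hconst := Fin.eq_apply_zero_of_apply_add_one_eq (f := fun i => Equiv.Perm.sign (x i))
    fun i => by
      rw [hsign, Int.units_pow_eq_pow_mod_two, Nat.odd_iff.mp hodd, pow_one]
  have hneg (i : Fin d) : Equiv.Perm.sign (x i) = -1 :=
    (hconst i).trans ((hconst j).symm.trans hj)
  refine ⟨hodd, hneg, ?_⟩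
  have hpow : (-1 : ℤˣ) ^ d = 1 := by
    simpa [List.prod_ofFn, map_list_prod, List.map_ofFn, Function.comp_def, hneg] using
      congrArg Equiv.Perm.sign hprod
  rw [← Nat.not_odd_iff_even]
  intro hd
  rw [hd.neg_one_pow] at hpow
  exact absurd hpow (by decide)
end
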